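/- Let i be a nonnegative integer and let α, β, ε be complex numbers. Assume that (β)_{m+n} and (1+α−β+ε−i)_n are nonzero for all nonnegative integers m, n, that no argument of Γ appearing on the right-hand side below is a nonpositive integer, and that the double series defining the Kampé de Fériet function converges absolutely. Then F^{1:1;2}_{1:0;1}[α : ε ; β−ε, 1+α−2β+ε−i ; β : — ; 1+α−β+ε−i ; 1/2, 1/2] = (2^{−i+α−2β+2ε} · Γ(1+α−β+ε−i)) / Γ(1+α−2β+2ε−i) · Σ_{r=0}^{i} C(i,r) · Γ(ε−β+(1+α−i+r)/2) / Γ((1+α−i+r)/2). -/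

import Mathlib

open Complex

noncomputable section

/-- Pochhammer symbol `(a)_n = a (a+1) ⋯ (a+n-1)`. -/
def poch (a : ℂ) (n : ℕ) : ℂ := ∏ k ∈ Finset.range n, (a + k)

/-- `z` is not a nonpositive integer. -/
def notNonposInt (z : ℂ) : Prop := ∀ n : ℕ, z ≠ -(n : ℂ)

/-- Term of the Kampé de Fériet double series `F^{1:1;2}_{1:0;1}`. -/
def kdfTerm (α ε b₁ b₂ β d₁ x y : ℂ) (p : ℕ × ℕ) : ℂ :=
  poch α (p.1 + p.2) * poch ε p.1 * poch b₁ p.2 * poch b₂ p.2 /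
    (poch β (p.1 + p.2) * poch d₁ p.2) * x ^ p.1 * y ^ p.2 /
    ((p.1.factorial : ℂ) * (p.2.factorial : ℂ))

open Filter Topology

lemma poch_zero (a : ℂ) : poch a 0 = 1 := by simp [poch]

lemma poch_succ (a : ℂ) (n : ℕ) : poch a (n + 1) = poch a n * (a + n) :=
  Finset.prod_range_succ _ _

lemma poch_succ_left (a : ℂ) (n : ℕ) : poch a (n + 1) = a * poch (a + 1) n := by
  rw [poch, Finset.prod_range_succ', mul_comm]
  simp only [Nat.cast_zero, add_zero, Nat.cast_add, Nat.cast_one, poch, add_comm, add_left_comm]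

lemma poch_ne_zero {c : ℂ} (hc : notNonposInt c) (n : ℕ) : poch c n ≠ 0 :=
  Finset.prod_ne_zero_iff.2 fun k _ h => hc k (eq_neg_of_add_eq_zero_left h)

lemma poch_eq_ascPochhammer_eval (a : ℂ) (n : ℕ) : poch a n = (ascPochhammer ℂ n).eval a := by
  induction n with
  | zero => simp [poch_zero]
  | succ n ih => rw [poch_succ, ih, ascPochhammer_succ_eval]

lemma notNonposInt.add_natCast {c : ℂ} (hc : notNonposInt c) (k : ℕ) : notNonposInt (c + k) := by
  intro n h
  apply hc (n + k)
  push_cast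
  linear_combination h

lemma notNonposInt.add_one {c : ℂ} (hc : notNonposInt c) : notNonposInt (c + 1) := by
  simpa using hc.add_natCast 1

lemma notNonposInt.ne_zero {c : ℂ} (hc : notNonposInt c) : c ≠ 0 := by
  simpa using hc 0

lemma notNonposInt.add_natCast_ne_zero {c : ℂ} (hc : notNonposInt c) (k : ℕ) : c + k ≠ 0 :=
  (hc.add_natCast k).ne_zero

lemma notNonposInt_one : notNonposInt 1 := by
  intro n h
  exact n.cast_add_one_ne_zero (R := ℂ) (by linear_combination h)

lemma notNonposInt.half {c : ℂ} (hc : notNonposInt c) : notNonposInt (c / 2) := by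
  intro n h
  apply hc (2 * n)
  push_cast
  linear_combination 2 * h

/-- Term of the Gauss series `₂F₁(a, b; c; 1/2)`. -/
def gaussTerm (a b c : ℂ) (n : ℕ) : ℂ :=
  poch a n * poch b n / (poch c n * n.factorial) * (1 / 2) ^ n

lemma gaussTerm_succ (a b c : ℂ) (n : ℕ) :
    gaussTerm a b c (n + 1) =
      (a + n) / (c + n) * ((b + n) / (1 + n)) * (1 / 2) * gaussTerm a b c n := by
  simp only [gaussTerm, poch_succ, Nat.factorial_succ, Nat.cast_mul, Nat.cast_add, Nat.cast_one,
    pow_succ, div_eq_mul_inv, mul_inv_rev, add_comm (n : ℂ) 1]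
  ring

lemma summable_norm_gaussTerm (a b c : ℂ) : Summable fun n => ‖gaussTerm a b c n‖ := by
  have key (x y : ℂ) : Tendsto (fun n : ℕ => (x + n) / (y + n)) atTop (𝓝 1) := by
    simpa using tendsto_add_mul_div_add_mul_atTop_nhds x y (1 : ℂ) one_ne_zero
  have h := (((key a c).mul (key b 1)).mul_const (1 / 2)).norm
  have h' := h.eventually_lt_const (u := 3 / 4) (by norm_num)
  refine summable_of_ratio_norm_eventually_le (r := 3 / 4) (by norm_num) ?_
  filter_upwards [h'] with n hn
  rw [norm_norm, norm_norm, gaussTerm_succ, norm_mul]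
  exact mul_le_mul_of_nonneg_right hn.le (norm_nonneg _)

lemma summable_gaussTerm (a b c : ℂ) : Summable (gaussTerm a b c) :=
  (summable_norm_gaussTerm a b c).of_norm

/-- Coefficientwise Euler transformation, i.e. the Pfaff–Saalschütz summation. -/
lemma euler_coeff {A B c : ℂ} (hc : notNonposInt c) (N : ℕ) :
    ∑ n ∈ Finset.range (N + 1), poch (c - A - B) (N - n) / ((N - n).factorial : ℂ) *
      (poch A n * poch B n / (poch c n * n.factorial)) =
      poch (c - A) N * poch (c - B) N / (poch c N * N.factorial) := by
  set w : ℕ → ℂ := fun k => poch (c - A - B) k / k.factorial with hw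
  set v : ℕ → ℂ := fun n => poch A n * poch B n / (poch c n * n.factorial) with hv
  have hws (k : ℕ) : w (k + 1) = (c - A - B + k) / (k + 1) * w k := by
    simp only [hw, poch_succ, Nat.factorial_succ, Nat.cast_mul, Nat.cast_add, Nat.cast_one,
      div_eq_mul_inv, mul_inv_rev]
    ring
  have hvs (n : ℕ) : (n + 1) * (c + n) * v (n + 1) = (A + n) * (B + n) * v n := by
    have h1 : (n : ℂ) + 1 ≠ 0 := n.cast_add_one_ne_zero
    have h2 := hc.add_natCast_ne_zero n
    have h3 := poch_ne_zero hc n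
    have h4 : (n.factorial : ℂ) ≠ 0 := by exact_mod_cast n.factorial_ne_zero
    simp only [hv, poch_succ, Nat.factorial_succ, Nat.cast_mul, Nat.cast_add, Nat.cast_one]
    field_simp
  change ∑ n ∈ Finset.range (N + 1), w (N - n) * v n = _
  induction N with
  | zero => simp [hw, hv, poch_zero]
  | succ N ih =>
    have tele : ∑ n ∈ Finset.range (N + 1),
        (((N : ℂ) + 1) * (c + N) * (w (N + 1 - n) * v n) -
          (c - A + N) * (c - B + N) * (w (N - n) * v n)) =
        -(((N : ℂ) + 1) * (c + N) * v (N + 1)) := by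
      have h0 := Finset.sum_range_sub
        (fun n : ℕ => -(w (N + 1 - n) * (n * (c + n - 1) * v n))) (N + 1)
      rw [Finset.sum_congr rfl (g := fun n =>
        (((N : ℂ) + 1) * (c + N) * (w (N + 1 - n) * v n) -
          (c - A + N) * (c - B + N) * (w (N - n) * v n)))] at h0
      · rw [h0]
        simp only [hw, Nat.sub_self, poch_zero]
        push_cast
        simp only [Nat.factorial_zero, Nat.cast_one, zero_mul, mul_zero, neg_zero, sub_zero]
        ring
      · intro n hn
        obtain ⟨k, rfl⟩ := Nat.exists_eq_add_of_le (Nat.lt_succ_iff.1 (Finset.mem_range.1 hn))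
        have e1 : n + k + 1 - (n + 1) = k := by omega
        have e2 : n + k + 1 - n = k + 1 := by omega
        have e3 : n + k - n = k := by omega
        have h1 : (k : ℂ) + 1 ≠ 0 := k.cast_add_one_ne_zero
        rw [e1, e2, e3, hws]
        have := hvs n
        push_cast
        field_simp
        linear_combination (-((k : ℂ) + 1) * w k) * this
    rw [Finset.sum_sub_distrib, ← Finset.mul_sum, ← Finset.mul_sum, ih] at tele
    rw [Finset.sum_range_succ, Nat.sub_self]
    have h1 : (N : ℂ) + 1 ≠ 0 := N.cast_add_one_ne_zero
    have h2 := hc.add_natCast_ne_zero N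
    have h3 := poch_ne_zero hc N
    have h4 : (N.factorial : ℂ) ≠ 0 := by exact_mod_cast N.factorial_ne_zero
    have h5 : w 0 = 1 := by simp [hw, poch_zero]
    have h6 : ((N : ℂ) + 1) * (c + N) ≠ 0 := mul_ne_zero h1 h2
    rw [h5, one_mul]
    apply mul_left_cancel₀ h6
    rw [mul_add]
    simp only [poch_succ, Nat.factorial_succ, Nat.cast_mul, Nat.cast_add, Nat.cast_one]
    have : ((N : ℂ) + 1) * (c + N) * ∑ n ∈ Finset.range (N + 1), w (N + 1 - n) * v n +
        ((N : ℂ) + 1) * (c + N) * v (N + 1) = (c - A + N) * (c - B + N) *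
        (poch (c - A) N * poch (c - B) N / (poch c N * N.factorial)) := by
      linear_combination tele
    rw [this]
    field_simp

lemma tsum_binomial_half (e : ℂ) :
    ∑' m : ℕ, poch e m / (m.factorial : ℂ) * (1 / 2) ^ m = (2 : ℂ) ^ e := by
  have h := (one_div_one_sub_cpow_hasFPowerSeriesOnBall_zero e).hasSum (y := 1 / 2)
    (by simp [enorm_eq_nnnorm])
  have hc (m : ℕ) : poch e m / (m.factorial : ℂ) = Ring.choose (e + m - 1) m := by
    have h1 : (m.factorial : ℂ) ≠ 0 := by exact_mod_cast m.factorial_ne_zero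
    rw [div_eq_iff h1, mul_comm, ← nsmul_eq_mul, Ring.choose,
      Ring.factorial_nsmul_multichoose_eq_ascPochhammer, Polynomial.ascPochhammer_smeval_eq_eval,
      poch_eq_ascPochhammer_eval]
    congr 1
    ring
  have h2 := h.tsum_eq
  simp only [FormalMultilinearSeries.ofScalars_apply_eq, smul_eq_mul, zero_add] at h2
  simp_rw [hc]
  rw [h2, show (1 : ℂ) - 1 / 2 = 2⁻¹ by norm_num,
    inv_cpow _ _ (by simp [ofNat_arg, Real.pi_ne_zero.symm])]
  simp

lemma euler_half {A B c : ℂ} (hc : notNonposInt c) :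
    ∑' n, gaussTerm (c - A) (c - B) c n = (2 : ℂ) ^ (c - A - B) * ∑' n, gaussTerm A B c n := by
  have h1 : Summable fun m : ℕ => ‖poch (c - A - B) m / (m.factorial : ℂ) * (1 / 2) ^ m‖ := by
    convert summable_norm_gaussTerm (c - A - B) 1 1 using 3 with m
    rw [gaussTerm, mul_comm (poch 1 m), mul_div_mul_right _ _ (poch_ne_zero notNonposInt_one m)]
  rw [← tsum_binomial_half,
    tsum_mul_tsum_eq_tsum_sum_range_of_summable_norm h1 (summable_norm_gaussTerm A B c)]
  congr 1
  ext N
  rw [gaussTerm, ← euler_coeff hc, ← Finset.sum_range_reflect, Finset.sum_mul]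
  refine Finset.sum_congr rfl fun n hn => ?_
  obtain ⟨k, rfl⟩ := Nat.exists_eq_add_of_le (Nat.lt_succ_iff.1 (Finset.mem_range.1 hn))
  rw [show n + k + 1 - 1 - n = k by omega, show n + k - k = n by omega,
    show n + k - n = k by omega, gaussTerm, pow_add]
  ring

lemma gaussTerm_contiguous {a b c : ℂ} (hc : notNonposInt c) :
    ∑' n, gaussTerm a b c n =
      ∑' n, gaussTerm (a - 1) b c n + b / (2 * c) * ∑' n, gaussTerm a (b + 1) (c + 1) n := by
  have h0 : gaussTerm a b c 0 = gaussTerm (a - 1) b c 0 := by simp [gaussTerm, poch_zero]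
  rw [(summable_gaussTerm a b c).tsum_eq_zero_add,
    (summable_gaussTerm (a - 1) b c).tsum_eq_zero_add, h0, add_assoc, ← tsum_mul_left,
    ← ((summable_nat_add_iff 1).2 (summable_gaussTerm (a - 1) b c)).tsum_add
      ((summable_gaussTerm a (b + 1) (c + 1)).mul_left _)]
  congr 2
  ext n
  have h1 : (n : ℂ) + 1 ≠ 0 := n.cast_add_one_ne_zero
  have h2 := hc.ne_zero
  have h3 := poch_ne_zero hc.add_one n
  have h4 : (n.factorial : ℂ) ≠ 0 := by exact_mod_cast n.factorial_ne_zero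
  simp only [gaussTerm]
  rw [poch_succ_left b, poch_succ_left c, poch_succ_left (a - 1), poch_succ a, sub_add_cancel,
    Nat.factorial_succ]
  push_cast
  field_simp
  ring

lemma bailey_shift (p : ℂ) {c : ℂ} (hc : notNonposInt c) :
    c * (c + 1) * ∑' n, gaussTerm p (1 - p) c n =
      (c + p) * (c + 1 - p) * ∑' n, gaussTerm p (1 - p) (c + 2) n := by
  have e2 : c + 1 + 1 = c + 2 := by ring
  have hc2 : notNonposInt (c + 2) := e2 ▸ hc.add_one.add_one
  set g : ℕ → ℂ := fun n => -2 * n * (c + 1 + n) * gaussTerm p (1 - p) (c + 2) n with hg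
  have hgs (n : ℕ) : g (n + 1) = -(p * (1 - p)) * gaussTerm (p + 1) (1 - p + 1) (c + 2) n := by
    have h1 : (n : ℂ) + 1 ≠ 0 := n.cast_add_one_ne_zero
    have h2 := hc2.add_natCast_ne_zero n
    have h3 := poch_ne_zero hc2 n
    have h4 : (n.factorial : ℂ) ≠ 0 := by exact_mod_cast n.factorial_ne_zero
    simp only [hg, gaussTerm]
    rw [poch_succ_left p, poch_succ_left (1 - p), poch_succ (c + 2), Nat.factorial_succ]
    push_cast
    field_simp
    ring
  have hgsum' : Summable fun n => g (n + 1) := by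
    simp_rw [hgs]
    exact (summable_gaussTerm _ _ _).mul_left _
  have hgsum : Summable g := (summable_nat_add_iff 1).1 hgsum'
  have hterm (n : ℕ) : c * (c + 1) * gaussTerm p (1 - p) c n -
      (c + p) * (c + 1 - p) * gaussTerm p (1 - p) (c + 2) n = g (n + 1) - g n := by
    have h1 : (n : ℂ) + 1 ≠ 0 := n.cast_add_one_ne_zero
    have h2 := hc2.add_natCast_ne_zero n
    have h3 := poch_ne_zero hc2 n
    have h4 := poch_ne_zero hc n
    have h5 : poch c n * (c + n) * (c + n + 1) = c * (c + 1) * poch (c + 2) n := by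
      have := poch_succ_left c (n + 1)
      rw [poch_succ, poch_succ, poch_succ_left (c + 1), e2] at this
      push_cast at this
      linear_combination this
    have h6 : c * (c + 1) * gaussTerm p (1 - p) c n =
        (c + n) * (c + n + 1) * gaussTerm p (1 - p) (c + 2) n := by
      have h6 : (n.factorial : ℂ) ≠ 0 := by exact_mod_cast n.factorial_ne_zero
      simp only [gaussTerm]
      field_simp
      linear_combination (-(poch p n * poch (1 - p) n)) * h5
    have h7 : g (n + 1) = -(p + n) * (1 - p + n) * gaussTerm p (1 - p) (c + 2) n := by
      simp only [hg]
      rw [gaussTerm_succ]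
      push_cast
      rw [add_comm (1 : ℂ) n]
      field_simp
      ring
    rw [h6, h7]
    simp only [hg]
    ring
  have hs := tsum_congr (L := .unconditional ℕ) hterm
  rw [((summable_gaussTerm _ _ _).mul_left _).tsum_sub ((summable_gaussTerm _ _ _).mul_left _),
    hgsum'.tsum_sub hgsum, tsum_mul_left, tsum_mul_left, hgsum.tsum_eq_zero_add] at hs
  have h0 : g 0 = 0 := by simp [hg]
  linear_combination hs - h0

lemma tendsto_tsum_gaussTerm_shift (a b c : ℂ) :
    Tendsto (fun k : ℕ => ∑' n, gaussTerm a b (c + 2 * k) n) atTop (𝓝 1) := by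
  have hre : Tendsto (fun k : ℕ => c.re + 2 * (k : ℝ)) atTop atTop :=
    tendsto_atTop_add_const_left _ _
      (tendsto_natCast_atTop_atTop.const_mul_atTop (by norm_num))
  have hinv (j : ℕ) : Tendsto (fun k : ℕ => (c + 2 * k + j)⁻¹) atTop (𝓝 0) := by
    apply tendsto_inv₀_cobounded.comp
    rw [← tendsto_norm_atTop_iff_cobounded]
    refine tendsto_atTop_mono (fun k => ?_) (tendsto_atTop_add_const_right _ (j : ℝ) hre)
    refine le_trans (le_of_eq ?_) (re_le_norm _)
    simp
  have hpoch (n : ℕ) : Tendsto (fun k : ℕ => (poch (c + 2 * k) n)⁻¹) atTop (𝓝 (0 ^ n)) := by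
    have := tendsto_finsetProd (Finset.range n) fun j _ => hinv j
    simpa [poch] using this
  have hlim : ∑' n : ℕ, poch a n * poch b n / n.factorial * (1 / 2) ^ n * 0 ^ n = 1 := by
    rw [tsum_eq_single 0 (fun n hn => by simp [hn])]
    simp [poch_zero]
  rw [← hlim]
  refine tendsto_tsum_of_dominated_convergence (summable_norm_gaussTerm a b 1) (fun n => ?_) ?_
  · refine ((hpoch n).const_mul _).congr fun k => ?_
    simp only [gaussTerm, div_eq_mul_inv, mul_inv]
    ring
  · filter_upwards [hre.eventually_ge_atTop 1] with k hk n
    have hle : ‖poch 1 n‖ ≤ ‖poch (c + 2 * k) n‖ := by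
      simp only [poch, norm_prod]
      refine Finset.prod_le_prod (fun _ _ => norm_nonneg _) fun j _ => ?_
      rw [← Nat.cast_one, ← Nat.cast_add, norm_natCast]
      refine le_trans ?_ (re_le_norm _)
      simpa using hk
    have hpos : 0 < ‖poch 1 n‖ := norm_pos_iff.2 (poch_ne_zero notNonposInt_one n)
    simp only [gaussTerm, norm_mul, norm_div]
    have hf : 0 < ‖(n.factorial : ℂ)‖ := norm_pos_iff.2 (by exact_mod_cast n.factorial_ne_zero)
    gcongr

lemma tendsto_poch_div (s : ℂ) :
    Tendsto (fun n : ℕ => poch s (n + 1) / ((n : ℂ) ^ s * n.factorial)) atTop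
      (𝓝 (Gamma s)⁻¹) := by
  have heq (n : ℕ) : (GammaSeq s n)⁻¹ = poch s (n + 1) / ((n : ℂ) ^ s * n.factorial) := by
    rw [GammaSeq, inv_div, poch]
  by_cases hs : notNonposInt s
  · exact ((GammaSeq_tendsto_Gamma s).inv₀ (Gamma_ne_zero hs)).congr heq
  · obtain ⟨m, rfl⟩ : ∃ m : ℕ, s = -m := by simpa [notNonposInt] using hs
    rw [Gamma_neg_nat_eq_zero, inv_zero]
    refine tendsto_const_nhds.congr' ?_
    filter_upwards [eventually_ge_atTop m] with n hn
    have : poch (-m) (n + 1) = 0 :=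
      Finset.prod_eq_zero (Finset.mem_range.2 (Nat.lt_succ_of_le hn)) (by simp)
    rw [this, zero_div]

/-- Bailey's summation theorem. -/
lemma bailey (p : ℂ) {c : ℂ} (hc : notNonposInt c) :
    ∑' n, gaussTerm p (1 - p) c n = Gamma (c / 2) * Gamma ((c + 1) / 2) /
      (Gamma ((c + p) / 2) * Gamma ((c + 1 - p) / 2)) := by
  have hiter (k : ℕ) : poch (c / 2) k * poch ((c + 1) / 2) k * ∑' n, gaussTerm p (1 - p) c n =
      poch ((c + p) / 2) k * poch ((c + 1 - p) / 2) k *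
        ∑' n, gaussTerm p (1 - p) (c + 2 * k) n := by
    induction k with
    | zero => simp [poch_zero]
    | succ k ih =>
      have h := bailey_shift p (c := c + 2 * k) (by simpa using hc.add_natCast (2 * k))
      rw [show c + 2 * (k : ℂ) + 2 = c + 2 * (k + 1 : ℕ) by push_cast; ring] at h
      simp only [poch_succ]
      linear_combination (c / 2 + k) * ((c + 1) / 2 + k) * ih +
        poch ((c + p) / 2) k * poch ((c + 1 - p) / 2) k / 4 * h
  have hL := ((tendsto_poch_div (c / 2)).mul (tendsto_poch_div ((c + 1) / 2))).mul_const
    (∑' n, gaussTerm p (1 - p) c n)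
  have hR := ((tendsto_poch_div ((c + p) / 2)).mul (tendsto_poch_div ((c + 1 - p) / 2))).mul
    ((tendsto_tsum_gaussTerm_shift p (1 - p) c).comp (tendsto_add_atTop_nat 1))
  have hlim := tendsto_nhds_unique_of_eventuallyEq hL hR (by
    filter_upwards [eventually_ne_atTop 0] with k hk
    have hk' : (k : ℂ) ≠ 0 := by exact_mod_cast hk
    simp only [Function.comp_apply]
    rw [div_mul_div_comm, div_mul_div_comm, div_mul_eq_mul_div, div_mul_eq_mul_div, hiter,
      mul_mul_mul_comm, mul_mul_mul_comm ((k : ℂ) ^ ((c + p) / 2)), ← cpow_add _ _ hk',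
      ← cpow_add _ _ hk',
      show c / 2 + (c + 1) / 2 = (c + p) / 2 + (c + 1 - p) / 2 by ring])
  have h1 := Gamma_ne_zero hc.half
  have h2 := Gamma_ne_zero hc.add_one.half
  rw [mul_one, ← mul_inv (Gamma (c / 2)), inv_mul_eq_iff_eq_mul₀ (mul_ne_zero h1 h2)] at hlim
  simp only [hlim, div_eq_mul_inv, mul_inv]

/-- Gauss's second summation theorem. -/
lemma gauss_second {a b c : ℂ} (hb : notNonposInt b) (hc : notNonposInt c)
    (habc : 2 * c = a + b + 1) :
    ∑' n, gaussTerm a b c n =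
      2 ^ (b - 1) * Gamma c / Gamma b * (Gamma (b / 2) / Gamma ((a + 1) / 2)) := by
  have hE := euler_half (A := c - a) (B := c - b) hc
  have hB := bailey (c - a) hc
  rw [show 1 - (c - a) = c - b by linear_combination -habc,
    show c + (c - a) = b + 1 by linear_combination habc,
    show c + 1 - (c - a) = a + 1 by ring] at hB
  rw [sub_sub_cancel, sub_sub_cancel, hB,
    show a - (c - b) = c - 1 by linear_combination -habc] at hE
  rw [hE]
  have hdc := Gamma_mul_Gamma_add_half (c / 2)
  have hdb := Gamma_mul_Gamma_add_half (b / 2)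
  rw [show c / 2 + 1 / 2 = (c + 1) / 2 by ring, mul_div_cancel₀ _ (two_ne_zero' ℂ)] at hdc
  rw [show b / 2 + 1 / 2 = (b + 1) / 2 by ring, mul_div_cancel₀ _ (two_ne_zero' ℂ)] at hdb
  have h1 := Gamma_ne_zero hb
  have h2 := Gamma_ne_zero hb.add_one.half
  have hp (x : ℂ) : (2 : ℂ) ^ (x - 1) * 2 ^ (1 - x) = 1 := by
    rw [← cpow_add _ _ two_ne_zero]
    simp
  have hG : 2 ^ (b - 1) * Gamma (b / 2) / Gamma b =
      (Real.sqrt Real.pi : ℂ) / Gamma ((b + 1) / 2) := by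
    rw [div_eq_div_iff h1 h2, mul_assoc, hdb]
    linear_combination (Gamma b * Real.sqrt Real.pi) * hp b
  rw [hdc]
  calc _ = (2 ^ (c - 1) * 2 ^ (1 - c)) * Gamma c * (Real.sqrt Real.pi / Gamma ((b + 1) / 2)) *
        (Gamma ((a + 1) / 2))⁻¹ := by
        simp only [div_eq_mul_inv, mul_inv]
        ring
    _ = _ := by
        rw [hp, ← hG]
        ring

/-- Generalized second Gauss summation theorem. -/
lemma gauss_second_general (i : ℕ) {a b c : ℂ} (hb : notNonposInt b) (hc : notNonposInt c)
    (habc : 2 * c = a + b + 1 - i) :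
    ∑' n, gaussTerm a b c n = 2 ^ (b - 1) * Gamma c / Gamma b *
      ∑ r ∈ Finset.range (i + 1),
        (i.choose r : ℂ) * Gamma ((b + r) / 2) / Gamma ((a + 1 - i + r) / 2) := by
  induction i generalizing a b c with
  | zero =>
    rw [gauss_second hb hc (by simpa using habc)]
    simp
  | succ i ih =>
    have h1 := ih (a := a - 1) hb hc (by rw [habc]; push_cast; ring)
    have h2 := ih (a := a) (b := b + 1) (c := c + 1) hb.add_one hc.add_one
      (by rw [mul_add, habc]; push_cast; ring)
    have hpas : ∑ r ∈ Finset.range (i + 1 + 1), ((i + 1).choose r : ℂ) * Gamma ((b + r) / 2) /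
          Gamma ((a + 1 - (i + 1 : ℕ) + r) / 2) =
        ∑ r ∈ Finset.range (i + 1), (i.choose r : ℂ) * Gamma ((b + r) / 2) /
          Gamma ((a - 1 + 1 - i + r) / 2) +
        ∑ r ∈ Finset.range (i + 1), (i.choose r : ℂ) * Gamma ((b + 1 + r) / 2) /
          Gamma ((a + 1 - i + r) / 2) := by
      set f : ℕ → ℂ := fun r => Gamma ((b + r) / 2) / Gamma ((a + 1 - (i + 1 : ℕ) + r) / 2) with hf
      have hl : ∀ j : ℕ, ∀ r : ℕ, (j.choose r : ℂ) * Gamma ((b + r) / 2) /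
          Gamma ((a + 1 - (i + 1 : ℕ) + r) / 2) = j.choose r * f r := fun j r => mul_div_assoc _ _ _
      have hr1 : ∀ r : ℕ, (i.choose r : ℂ) * Gamma ((b + r) / 2) /
          Gamma ((a - 1 + 1 - i + r) / 2) = i.choose r * f r := fun r => by
        rw [← hl]; congr 3; push_cast; ring
      have hr2 : ∀ r : ℕ, (i.choose r : ℂ) * Gamma ((b + 1 + r) / 2) /
          Gamma ((a + 1 - i + r) / 2) = i.choose r * f (r + 1) := fun r => by
        rw [mul_div_assoc, hf]; congr 4 <;> push_cast <;> ring
      simp_rw [hl, hr1, hr2]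
      rw [Finset.sum_range_succ']
      simp_rw [Nat.choose_succ_succ, Nat.cast_add, add_mul, Finset.sum_add_distrib]
      rw [Finset.sum_range_succ' (fun r => (i.choose r : ℂ) * f r),
        Finset.sum_range_succ (fun r => (i.choose (r + 1) : ℂ) * f (r + 1))]
      simp
      ring
    rw [gaussTerm_contiguous hc, h1, h2, hpas, mul_add, Gamma_add_one _ hb.ne_zero,
      Gamma_add_one _ hc.ne_zero, show b + 1 - 1 = (b - 1) + 1 by ring,
      cpow_add _ _ two_ne_zero, cpow_one]
    have := hb.ne_zero
    have := hc.ne_zero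
    have := Gamma_ne_zero hb
    field_simp

lemma tsum_kdfTerm {α ε β d : ℂ} (hβ : ∀ n, poch β n ≠ 0) (hd : notNonposInt d)
    (hsum : Summable fun p : ℕ × ℕ => kdfTerm α ε (β - ε) (d - β) β d (1 / 2) (1 / 2) p) :
    ∑' p : ℕ × ℕ, kdfTerm α ε (β - ε) (d - β) β d (1 / 2) (1 / 2) p =
      ∑' n, gaussTerm α (d - β + ε) d n := by
  have hsum' := Finset.HasAntidiagonal.sigmaAntidiagonalEquivProd.summable_iff.2 hsum
  simp only [Function.comp_def] at hsum'
  rw [← Finset.HasAntidiagonal.sigmaAntidiagonalEquivProd.tsum_eq,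
    hsum'.tsum_sigma' fun n => (hasSum_fintype _).summable]
  refine tsum_congr fun N => ?_
  rw [tsum_fintype]
  have h := euler_coeff (A := β - ε) (B := d - β) hd N
  rw [sub_sub_cancel, show d - (β - ε) - (d - β) = ε by ring,
    show d - (β - ε) = d - β + ε by ring] at h
  have hg : gaussTerm α (d - β + ε) d N = poch α N / poch β N * (1 / 2) ^ N *
      (poch (d - β + ε) N * poch β N / (poch d N * N.factorial)) := by
    have := hβ N
    rw [gaussTerm]
    field_simp
  rw [hg, ← h, Finset.mul_sum]
  simp only [Finset.HasAntidiagonal.sigmaAntidiagonalEquivProd_apply]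
  rw [Finset.univ_eq_attach, Finset.sum_attach (Finset.HasAntidiagonal.antidiagonal N)
    (fun p => kdfTerm α ε (β - ε) (d - β) β d (1 / 2) (1 / 2) p),
    ← Finset.Nat.sum_antidiagonal_swap, Finset.Nat.sum_antidiagonal_eq_sum_range_succ_mk]
  refine Finset.sum_congr rfl fun n hn => ?_
  obtain ⟨k, rfl⟩ := Nat.exists_eq_add_of_le (Nat.lt_succ_iff.1 (Finset.mem_range.1 hn))
  simp only [kdfTerm, Prod.swap_prod_mk]
  rw [show n + k - n = k by omega, add_comm k n, pow_add]
  simp only [div_eq_mul_inv, mul_inv]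
  ring

theorem stmt_3 (i : ℕ) (α β ε : ℂ)
    (hβ : ∀ m n : ℕ, poch β (m + n) ≠ 0)
    (hd : ∀ n : ℕ, poch (1 + α - β + ε - (i : ℂ)) n ≠ 0)
    (hΓ1 : notNonposInt (1 + α - β + ε - (i : ℂ)))
    (hΓ2 : notNonposInt (1 + α - 2 * β + 2 * ε - (i : ℂ)))
    (hΓs : ∀ r : ℕ, r ≤ i →
      notNonposInt (ε - β + (1 + α - (i : ℂ) + (r : ℂ)) / 2) ∧ notNonposInt ((1 + α - (i : ℂ) + (r : ℂ)) / 2))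
    (hsum : Summable fun p : ℕ × ℕ => ‖kdfTerm α ε (β - ε) (1 + α - 2 * β + ε - (i : ℂ)) β (1 + α - β + ε - (i : ℂ)) (1/2) (1/2) p‖) :
    (∑' p : ℕ × ℕ, kdfTerm α ε (β - ε) (1 + α - 2 * β + ε - (i : ℂ)) β (1 + α - β + ε - (i : ℂ)) (1/2) (1/2) p) =
      (2 : ℂ) ^ (-(i : ℂ) + α - 2 * β + 2 * ε) * Gamma (1 + α - β + ε - (i : ℂ)) /
        Gamma (1 + α - 2 * β + 2 * ε - (i : ℂ)) *
      ∑ r ∈ Finset.range (i + 1), (i.choose r : ℂ) *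
        Gamma (ε - β + (1 + α - (i : ℂ) + (r : ℂ)) / 2) /
        Gamma ((1 + α - (i : ℂ) + (r : ℂ)) / 2) := by
  have hb₂ : 1 + α - β + ε - (i : ℂ) - β = 1 + α - 2 * β + ε - i := by ring
  have h1 := tsum_kdfTerm (ε := ε) (fun n => by simpa using hβ 0 n) hΓ1
    (by rw [hb₂]; exact hsum.of_norm)
  rw [hb₂,
    show 1 + α - 2 * β + ε - (i : ℂ) + ε = 1 + α - 2 * β + 2 * ε - i by ring] at h1
  rw [h1, gauss_second_general i hΓ2 hΓ1 (by ring)]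
  congr 1
  · congr 3
    ring
  · refine Finset.sum_congr rfl fun r _ => ?_
    congr 3 <;> ring
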